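/- Let L be a connected simple graph with finite vertex set V, let A_L be its right-angled Artin group, φ : A_L → ℤ the homomorphism sending every generator to 1, and H_L = ker φ the Bestvina–Brady group. Let Q be a finite group acting on V preserving adjacency, and suppose: for every ordered pair (x, y) of adjacent vertices there exist a vertex z adjacent to both x and y and an element q ∈ Q with q·x = y and q·z = z. Let ψ : Q → Aut(A_L) be a homomorphism satisfying ψ(q)(of v) = of (q·v) for all q ∈ Q and v ∈ V, and let ψ' : Q → Aut(H_L) be a homomorphism compatible with ψ, i.e., the inclusion H_L → A_L intertwines ψ'(q) and ψ(q) for every q ∈ Q. Then in the semidirect product M = H_L ⋊_{ψ'} Q, the conjugates of the canonical copy inr(Q) of Q generate the entire group M; that is, the normal closure of inr(Q) in M equals M. -/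

import Mathlib

/-- The relators of the right-angled Artin group associated to a simple graph:
commutators of pairs of adjacent vertices. -/
def raagRels {V : Type*} (L : SimpleGraph V) : Set (FreeGroup V) :=
  {r | ∃ x y, L.Adj x y ∧
    r = FreeGroup.of x * FreeGroup.of y * (FreeGroup.of x)⁻¹ * (FreeGroup.of y)⁻¹}

/-- The right-angled Artin group associated to a simple graph. -/
abbrev RAAG {V : Type*} (L : SimpleGraph V) : Type _ := PresentedGroup (raagRels L)

namespace RAAG

variable {V : Type*} {L : SimpleGraph V}

theorem of_commute {x y : V} (h : L.Adj x y) :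
    Commute (PresentedGroup.of x : RAAG L) (PresentedGroup.of y) := by
  have hrel : (PresentedGroup.of x * PresentedGroup.of y * (PresentedGroup.of x)⁻¹ *
      (PresentedGroup.of y)⁻¹ : RAAG L) = 1 :=
    PresentedGroup.one_of_mem (rels := raagRels L) ⟨x, y, h, rfl⟩
  rw [mul_inv_eq_one, mul_inv_eq_iff_eq_mul] at hrel
  exact hrel

/-- The subgroup generated by the quotients of adjacent generators. -/
def edgeSubgroup (L : SimpleGraph V) : Subgroup (RAAG L) :=
  Subgroup.closure {g | ∃ x y, L.Adj x y ∧
    g = PresentedGroup.of x * (PresentedGroup.of y)⁻¹}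

theorem of_mul_inv_mem_of_adj {x y : V} (h : L.Adj x y) :
    (PresentedGroup.of x * (PresentedGroup.of y)⁻¹ : RAAG L) ∈ edgeSubgroup L :=
  Subgroup.subset_closure ⟨x, y, h, rfl⟩

theorem of_mul_inv_mem (hL : L.Connected) (x y : V) :
    (PresentedGroup.of x * (PresentedGroup.of y)⁻¹ : RAAG L) ∈ edgeSubgroup L := by
  obtain ⟨p⟩ := hL.preconnected x y
  induction p with
  | nil => simp [one_mem]
  | cons h _ ih => simpa [mul_assoc] using mul_mem (of_mul_inv_mem_of_adj h) ih

theorem inv_mul_of_mem (hL : L.Connected) (x y : V) :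
    ((PresentedGroup.of x)⁻¹ * PresentedGroup.of y : RAAG L) ∈ edgeSubgroup L := by
  obtain ⟨p⟩ := hL.preconnected x y
  induction p with
  | nil => simp [one_mem]
  | cons h _ ih =>
    have hmem := of_mul_inv_mem_of_adj h.symm
    rw [(of_commute h.symm).inv_right.eq] at hmem
    simpa [mul_assoc] using mul_mem hmem ih

theorem conj_mem_edgeSubgroup {g : RAAG L}
    (hg : ∀ x : V, ∃ c : RAAG L, Commute c (PresentedGroup.of x) ∧
      (∀ y, L.Adj x y → Commute c (PresentedGroup.of y)) ∧ g * c⁻¹ ∈ edgeSubgroup L)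
    {n : RAAG L} (hn : n ∈ edgeSubgroup L) : g * n * g⁻¹ ∈ edgeSubgroup L := by
  induction hn using Subgroup.closure_induction with
  | mem n hn =>
    obtain ⟨x, y, h, rfl⟩ := hn
    obtain ⟨c, hcx, hcy, hgc⟩ := hg x
    have hc := (hcx.mul_right (hcy y h).inv_right).eq
    have key := mul_mem (mul_mem hgc (of_mul_inv_mem_of_adj h)) (inv_mem hgc)
    convert key using 1
    rw [mul_inv_rev, inv_inv, mul_assoc g, mul_assoc g, mul_assoc g, ← mul_assoc _ c, mul_assoc c⁻¹,
      ← hc]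
    group
  | one => simp [one_mem]
  | mul a b _ _ ha hb => simpa [mul_assoc] using mul_mem ha hb
  | inv a _ ha => simpa [mul_assoc] using inv_mem ha

theorem edgeSubgroup_normal (hL : L.Connected) : (edgeSubgroup L).Normal := by
  refine ⟨fun n hn g => ?_⟩
  have hg : g ∈ Subgroup.closure (Set.range (PresentedGroup.of (rels := raagRels L))) := by
    rw [PresentedGroup.closure_range_of]
    exact Subgroup.mem_top g
  induction hg using Subgroup.closure_induction'' generalizing n with
  | one => simpa using hn
  | mem _ hw =>
    obtain ⟨w, rfl⟩ := hw
    exact conj_mem_edgeSubgroup (fun x => ⟨_, Commute.refl _, fun _ h => of_commute h,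
      of_mul_inv_mem hL w x⟩) hn
  | inv_mem _ hw =>
    obtain ⟨w, rfl⟩ := hw
    exact conj_mem_edgeSubgroup (fun x => ⟨_, (Commute.refl _).inv_left,
      fun _ h => (of_commute h).inv_left, by simpa using inv_mul_of_mem hL w x⟩) hn
  | mul a b _ _ ha hb => simpa [mul_assoc] using ha _ (hb _ hn)

/-- The Bestvina–Brady group of a connected graph is generated by quotients of adjacent
generators. -/
theorem ker_le_edgeSubgroup (hL : L.Connected) (φ : RAAG L →* Multiplicative ℤ)
    (hφ : ∀ v : V, φ (PresentedGroup.of v) = Multiplicative.ofAdd 1) :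
    φ.ker ≤ edgeSubgroup L := by
  have := edgeSubgroup_normal hL
  obtain ⟨v⟩ := hL.nonempty
  have hfac : QuotientGroup.mk' (edgeSubgroup L) =
      (zpowersHom _ (QuotientGroup.mk' (edgeSubgroup L) (PresentedGroup.of v))).comp φ := by
    refine PresentedGroup.ext fun x => ?_
    have hx := (edgeSubgroup_normal hL).mem_comm (of_mul_inv_mem hL v x)
    simp only [MonoidHom.comp_apply, hφ, zpowersHom_apply, toAdd_ofAdd, zpow_one]
    exact QuotientGroup.eq.mpr hx
  intro a ha
  have h := DFunLike.congr_fun hfac a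
  rw [MonoidHom.comp_apply, MonoidHom.mem_ker.mp ha, map_one] at h
  exact (QuotientGroup.eq_one_iff a).mp h

end RAAG

theorem SemidirectProduct.inl_mul_inv_mem_normalClosure {H Q : Type*} [Group H] [Group Q]
    (θ : Q →* MulAut H) (q : Q) (h : H) :
    (SemidirectProduct.inl (h * (θ q h)⁻¹) : H ⋊[θ] Q) ∈
      Subgroup.normalClosure (Set.range (⇑(SemidirectProduct.inr : Q →* H ⋊[θ] Q))) := by
  have hq : (SemidirectProduct.inr q : H ⋊[θ] Q) ∈
      Subgroup.normalClosure (Set.range (⇑(SemidirectProduct.inr : Q →* H ⋊[θ] Q))) :=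
    Subgroup.subset_normalClosure ⟨q, rfl⟩
  have hconj := mul_mem (Subgroup.normalClosure_normal.conj_mem _ hq (SemidirectProduct.inl h))
    (inv_mem hq)
  simpa [SemidirectProduct.inl_aut, mul_assoc] using hconj

theorem stmt8 {V : Type*} [Finite V] (L : SimpleGraph V) (hconn : L.Connected)
    (φ : RAAG L →* Multiplicative ℤ)
    (hφ : ∀ v : V, φ (PresentedGroup.of v) = Multiplicative.ofAdd 1)
    (Q : Type*) [Group Q] [Finite Q] [MulAction Q V]
    (hadj : ∀ (q : Q) (x y : V), L.Adj x y → L.Adj (q • x) (q • y))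
    (htri : ∀ x y : V, L.Adj x y →
      ∃ (z : V) (q : Q), L.Adj x z ∧ L.Adj y z ∧ q • x = y ∧ q • z = z)
    (ψ : Q →* MulAut (RAAG L))
    (hψ : ∀ (q : Q) (v : V), ψ q (PresentedGroup.of v) = PresentedGroup.of (q • v))
    (ψ' : Q →* MulAut ↥φ.ker)
    (hψ' : ∀ (q : Q) (h : ↥φ.ker), ((ψ' q h : ↥φ.ker) : RAAG L) = ψ q (h : RAAG L)) :
    Subgroup.normalClosure
        (Set.range (⇑(SemidirectProduct.inr : Q →* ↥φ.ker ⋊[ψ'] Q))) = ⊤ := by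
  set N := Subgroup.normalClosure
    (Set.range (⇑(SemidirectProduct.inr : Q →* ↥φ.ker ⋊[ψ'] Q))) with hN
  have hedge : RAAG.edgeSubgroup L ≤ (N.comap SemidirectProduct.inl).map φ.ker.subtype := by
    refine (Subgroup.closure_le _).mpr ?_
    rintro _ ⟨x, y, hxy, rfl⟩
    obtain ⟨z, q, -, -, hqx, hqz⟩ := htri x y hxy
    let h : ↥φ.ker := ⟨PresentedGroup.of x * (PresentedGroup.of z)⁻¹, by
      simp [MonoidHom.mem_ker, hφ]⟩
    refine ⟨h * (ψ' q h)⁻¹, SemidirectProduct.inl_mul_inv_mem_normalClosure ψ' q h, ?_⟩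
    simp [h, hψ', hψ, hqx, hqz]
  have hinl : ∀ h : ↥φ.ker, (SemidirectProduct.inl h : ↥φ.ker ⋊[ψ'] Q) ∈ N := by
    intro h
    obtain ⟨k, hk, hkh⟩ := hedge (RAAG.ker_le_edgeSubgroup hconn φ hφ h.2)
    rwa [← Subtype.ext hkh]
  refine eq_top_iff.mpr fun m _ => ?_
  rw [← SemidirectProduct.inl_left_mul_inr_right m]
  exact mul_mem (hinl _) (Subgroup.subset_normalClosure ⟨m.right, rfl⟩)
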